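/- arXiv:1310.2001 — 2 statements merged into one kernel-verified Lean document; each statement's English description precedes it below -/
import Mathlib

section
/- Let X = {X^n} be an i.i.d. source on a countable alphabet with entropy H(X) (base K) and finite variance σ² = E[(−log_K P_X(X) − H(X))²] with σ > 0. Then for 0 < ε < 1, the infimum of (ε, H(X)/α_c)-achievable second-order overflow thresholds is L(ε, H(X)/α_c | X) = (σ/α_c)·Φ⁻¹(1 − ε), where Φ is the standard Gaussian CDF. -/
/-- Additive cost of a string over the code alphabet. -/
noncomputable def strCost {U : Type*} (c : U → ℝ) (s : List U) : ℝ := (s.map c).sum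

/-- Probability of a set under a (real-valued) distribution. -/
noncomputable def prob {X : Type*} (P : X → ℝ) (S : Set X) : ℝ := ∑' x, S.indicator P x

/-- Standard Gaussian cumulative distribution function. -/
noncomputable def stdGaussianCDF (T : ℝ) : ℝ :=
  ∫ y in Set.Iic T, (Real.sqrt (2 * Real.pi))⁻¹ * Real.exp (-(y ^ 2) / 2)

open MeasureTheory ProbabilityTheory

lemma kraft_finset {U : Type*} [Fintype U] {p : U → ℝ} (hp0 : ∀ u, 0 ≤ p u)
    (hp1 : ∑ u, p u ≤ 1) (N : ℕ) (S : Finset (List U)) (hlen : ∀ s ∈ S, s.length ≤ N)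
    (hS : ∀ s ∈ S, ∀ t ∈ S, s <+: t → s = t) : ∑ s ∈ S, (s.map p).prod ≤ 1 := by
  classical
  induction N generalizing S with
  | zero =>
    have h : S ⊆ {[]} := fun s hs ↦ by simpa using hlen s hs
    calc _ ≤ ∑ s ∈ {[]}, (s.map p).prod :=
          Finset.sum_le_sum_of_subset_of_nonneg h (by simp)
      _ ≤ 1 := by simp
  | succ N ih =>
    by_cases hnil : [] ∈ S
    · have h : S ⊆ {[]} := fun s hs ↦ by simpa using (hS [] hnil s hs List.nil_prefix).symm
      calc _ ≤ ∑ s ∈ {[]}, (s.map p).prod :=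
            Finset.sum_le_sum_of_subset_of_nonneg h (by simp)
        _ ≤ 1 := by simp
    · let R : U → Finset (List U) := fun u ↦
        S.preimage (List.cons u) (List.cons_injective.injOn)
      have hR : ∀ u t, t ∈ R u ↔ u :: t ∈ S := fun u t ↦ by simp [R]
      have hsum : ∑ s ∈ S, (s.map p).prod = ∑ u, ∑ t ∈ R u, p u * (t.map p).prod := by
        rw [Finset.sum_sigma']
        symm
        refine Finset.sum_bij (fun x _ ↦ x.1 :: x.2) ?_ ?_ ?_ ?_
        · rintro ⟨u, t⟩ h
          simpa [hR] using h
        · rintro ⟨u, t⟩ _ ⟨v, r⟩ _ h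
          simp only [List.cons.injEq] at h
          obtain ⟨rfl, rfl⟩ := h
          rfl
        · intro s hs
          cases s with
          | nil => exact absurd hs hnil
          | cons u t => exact ⟨⟨u, t⟩, by simpa [hR] using hs, rfl⟩
        · simp
      rw [hsum]
      refine le_trans (Finset.sum_le_sum fun u _ ↦ ?_) hp1
      rw [← Finset.mul_sum]
      refine mul_le_of_le_one_right (hp0 u) (ih (R u) (fun t ht ↦ ?_) fun s hs t ht hst ↦ ?_)
      · simpa using hlen _ ((hR u t).1 ht)
      · simpa using hS _ ((hR u s).1 hs) _ ((hR u t).1 ht) (by simpa using hst)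

lemma exists_lt_sum_range_succ {f : ℕ → ℝ} {m : ℝ} (hm : 0 ≤ m) {n : ℕ}
    (h : m < ∑ i ∈ Finset.range n, f i) :
    ∃ k < n, ∑ i ∈ Finset.range k, f i ≤ m ∧ m < ∑ i ∈ Finset.range k, f i + f k := by
  induction n with
  | zero => simp at h; linarith
  | succ n ih =>
    by_cases h' : m < ∑ i ∈ Finset.range n, f i
    · obtain ⟨k, hk, h1⟩ := ih h'
      exact ⟨k, by omega, h1⟩
    · exact ⟨n, by omega, not_lt.1 h', by rwa [← Finset.sum_range_succ]⟩

lemma exists_interval_partition {U : Type*} [Fintype U] {p : U → ℝ} (hp0 : ∀ u, 0 ≤ p u)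
    (hp1 : ∑ u, p u = 1) :
    ∃ F : U → ℝ, (∀ u, 0 ≤ F u) ∧ (∀ u, F u + p u ≤ 1) ∧
      ∀ m, 0 ≤ m → m < 1 → ∃ u, F u ≤ m ∧ m < F u + p u := by
  let e := Fintype.equivFin U
  let g : ℕ → ℝ := fun i ↦ if h : i < Fintype.card U then p (e.symm ⟨i, h⟩) else 0
  have hg0 : ∀ i, 0 ≤ g i := fun i ↦ by
    simp only [g]; split_ifs
    · exact hp0 _
    · exact le_rfl
  have hge : ∀ u, g (e u) = p u := fun u ↦ by simp [g]
  have hgs : ∑ i ∈ Finset.range (Fintype.card U), g i = 1 := by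
    rw [← hp1, ← Fin.sum_univ_eq_sum_range, ← Equiv.sum_comp e]
    exact Finset.sum_congr rfl fun u _ ↦ hge u
  refine ⟨fun u ↦ ∑ i ∈ Finset.range (e u), g i, fun u ↦ Finset.sum_nonneg fun i _ ↦ hg0 i,
    fun u ↦ ?_, fun m hm0 hm1 ↦ ?_⟩
  · rw [← hge, ← Finset.sum_range_succ, ← hgs]
    exact Finset.sum_le_sum_of_subset_of_nonneg
      (Finset.range_subset_range.2 (e u).2) fun i _ _ ↦ hg0 i
  · obtain ⟨k, hk, h1, h2⟩ := exists_lt_sum_range_succ hm0 (hm1.trans_eq hgs.symm)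
    refine ⟨e.symm ⟨k, hk⟩, by simpa using h1, ?_⟩
    rw [← hge]
    simpa using h2

/-- Left endpoint of the subinterval of `[0, 1)` attached to a string, when the letter `u` is
attached to `[F u, F u + p u)`. -/
def leftEnd {U : Type*} (F p : U → ℝ) : List U → ℝ
  | [] => 0
  | u :: s => F u + p u * leftEnd F p s

section Interval

variable {U : Type*} {F p : U → ℝ}

lemma leftEnd_append (s t : List U) :
    leftEnd F p (s ++ t) = leftEnd F p s + (s.map p).prod * leftEnd F p t := by
  induction s with
  | nil => simp [leftEnd]
  | cons u s ih => simp [leftEnd, ih]; ring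

lemma prod_map_nonneg (hp0 : ∀ u, 0 ≤ p u) (s : List U) : 0 ≤ (s.map p).prod :=
  List.prod_nonneg (by simpa using fun u _ ↦ hp0 u)

lemma leftEnd_mem (hp0 : ∀ u, 0 ≤ p u) (hF0 : ∀ u, 0 ≤ F u) (hF1 : ∀ u, F u + p u ≤ 1)
    (s : List U) : 0 ≤ leftEnd F p s ∧ leftEnd F p s + (s.map p).prod ≤ 1 := by
  induction s with
  | nil => simp [leftEnd]
  | cons u s ih =>
    simp only [leftEnd, List.map_cons, List.prod_cons]
    have h1 := mul_le_mul_of_nonneg_left ih.2 (hp0 u)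
    have h2 := mul_nonneg (hp0 u) ih.1
    exact ⟨by linarith [hF0 u], by linarith [hF1 u]⟩

lemma leftEnd_of_prefix (hp0 : ∀ u, 0 ≤ p u) (hF0 : ∀ u, 0 ≤ F u) (hF1 : ∀ u, F u + p u ≤ 1)
    {s t : List U} (h : s <+: t) :
    leftEnd F p s ≤ leftEnd F p t ∧
      leftEnd F p t + (t.map p).prod ≤ leftEnd F p s + (s.map p).prod := by
  obtain ⟨r, rfl⟩ := h
  obtain ⟨h0, h1⟩ := leftEnd_mem hp0 hF0 hF1 r
  rw [leftEnd_append, List.map_append, List.prod_append]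
  have h2 := mul_le_mul_of_nonneg_left h1 (prod_map_nonneg hp0 s)
  have h3 := mul_nonneg (prod_map_nonneg hp0 s) h0
  exact ⟨by linarith, by linarith⟩

lemma exists_string_of_pow_le {q r : ℝ} (hq : 0 < q) (hqp : ∀ u, q ≤ p u) (hpr : ∀ u, p u ≤ r)
    (hcover : ∀ m, 0 ≤ m → m < 1 → ∃ u, F u ≤ m ∧ m < F u + p u)
    (n : ℕ) (δ : ℝ) (hδ : 0 < δ) (hn : r ^ n ≤ δ) (m : ℝ) (hm0 : 0 ≤ m) (hm1 : m < 1) :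
    ∃ s : List U, leftEnd F p s ≤ m ∧ m < leftEnd F p s + (s.map p).prod ∧
      (s.map p).prod ≤ δ ∧ (1 ≤ δ → (s.map p).prod = 1) ∧ (δ < 1 → q * δ ≤ (s.map p).prod) := by
  induction n generalizing δ m with
  | zero =>
    simp only [pow_zero] at hn
    exact ⟨[], by simpa [leftEnd] using hm0, by simpa [leftEnd] using hm1, by simpa using hn,
      by simp, fun h ↦ absurd hn h.not_ge⟩
  | succ n ih =>
    by_cases h1 : 1 ≤ δ
    · exact ⟨[], by simpa [leftEnd] using hm0, by simpa [leftEnd] using hm1, by simpa using h1,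
        by simp, fun h ↦ absurd h1 h.not_ge⟩
    push Not at h1
    obtain ⟨u, hu1, hu2⟩ := hcover m hm0 hm1
    have hpu : 0 < p u := hq.trans_le (hqp u)
    have hr : 0 < r := hpu.trans_le (hpr u)
    obtain ⟨s, hs1, hs2, hs3, hs4, hs5⟩ := ih (δ / p u) (by positivity)
      (by
        rw [le_div_iff₀ hpu]
        calc r ^ n * p u ≤ r ^ n * r := by gcongr; exact hpr u
          _ ≤ δ := by rwa [← pow_succ])
      ((m - F u) / p u) (div_nonneg (by linarith) hpu.le) (by rw [div_lt_one hpu]; linarith)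
    rw [le_div_iff₀ hpu] at hs1 hs3
    rw [div_lt_iff₀ hpu] at hs2
    refine ⟨u :: s, ?_, ?_, ?_, fun h ↦ absurd h1 h.not_gt, fun _ ↦ ?_⟩
    · simp only [leftEnd]; linarith
    · simp only [leftEnd, List.map_cons, List.prod_cons]; linarith
    · simp only [List.map_cons, List.prod_cons]; linarith
    · simp only [List.map_cons, List.prod_cons]
      by_cases h : 1 ≤ δ / p u
      · rw [hs4 h, mul_one]
        exact (mul_le_of_le_one_right hq.le h1.le).trans (hqp u)
      · have := hs5 (not_le.1 h)
        rw [← mul_div_assoc, div_le_iff₀ hpu] at this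
        linarith

end Interval

lemma exists_prefix_code {U X : Type*} [Fintype U] [Countable X] {p : U → ℝ} {q r : ℝ}
    (hq : 0 < q) (hqp : ∀ u, q ≤ p u) (hpr : ∀ u, p u ≤ r) (hr : r < 1) (hp1 : ∑ u, p u = 1)
    {Q : X → ℝ} (hQ : ∀ x, 0 < Q x) (hQs : Summable Q) (hQ1 : ∑' x, Q x ≤ 1) :
    ∃ φ : X → List U, (∀ x, φ x ≠ []) ∧ (∀ x y, φ x <+: φ y → x = y) ∧
      ∀ x, q / 2 * Q x ≤ ((φ x).map p).prod := by
  classical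
  obtain ⟨e, he⟩ := exists_injective_nat X
  have hp0 : ∀ u, 0 ≤ p u := fun u ↦ hq.le.trans (hqp u)
  obtain ⟨F, hF0, hF1, hcover⟩ := exists_interval_partition hp0 hp1
  let L : X → ℝ := fun x ↦ ∑' y, Set.indicator {y | e y < e x} Q y
  have hL0 : ∀ x, 0 ≤ L x := fun x ↦ tsum_nonneg fun y ↦ Set.indicator_nonneg (fun _ _ ↦ (hQ _).le) _
  have hLadd : ∀ x, L x + Q x = ∑' y, Set.indicator {y | e y ≤ e x} Q y := fun x ↦ by
    have h1 : Q x = ∑' y, Set.indicator {x} Q y := by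
      rw [tsum_eq_single x]
      · simp
      · intro y hy; simp [hy]
    rw [h1, ← (hQs.indicator _).tsum_add (hQs.indicator _)]
    refine tsum_congr fun y ↦ ?_
    simp only [Set.indicator_apply, Set.mem_ofPred_eq, Set.mem_singleton_iff]
    have : y = x ↔ e y = e x := he.eq_iff.symm
    rw [this]
    rcases lt_trichotomy (e y) (e x) with h | h | h
    · simp [h, h.le, h.ne]
    · simp [h]
    · simp [h.not_gt, h.not_ge, h.ne']
  have hL1 : ∀ x, L x + Q x ≤ 1 := fun x ↦ by
    rw [hLadd]
    exact ((hQs.indicator _).tsum_le_tsum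
      (fun y ↦ Set.indicator_le_self' (fun _ _ ↦ (hQ _).le) y) hQs).trans hQ1
  have hLlt : ∀ x y, e x < e y → L x + Q x ≤ L y := fun x y h ↦ by
    rw [hLadd]
    exact (hQs.indicator _).tsum_le_tsum (Set.indicator_le_indicator_of_subset
      (fun z (hz : e z ≤ e x) ↦ hz.trans_lt h) fun _ ↦ (hQ _).le) (hQs.indicator _)
  have hex : ∀ x, ∃ s : List U, L x ≤ leftEnd F p s ∧
      leftEnd F p s + (s.map p).prod ≤ L x + Q x ∧ s ≠ [] ∧ q / 2 * Q x ≤ (s.map p).prod := by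
    intro x
    have hx := hQ x
    obtain ⟨n, hn⟩ := exists_pow_lt_of_lt_one (half_pos hx) hr
    obtain ⟨s, h1, h2, h3, -, h5⟩ := exists_string_of_pow_le hq hqp hpr hcover n (Q x / 2)
      (half_pos hx) hn.le (L x + Q x / 2) (by linarith [hL0 x]) (by linarith [hL1 x])
    refine ⟨s, by linarith, by linarith, ?_, by linarith [h5 (by linarith [hL0 x, hL1 x])]⟩
    rintro rfl
    simp only [List.map_nil, List.prod_nil] at h3
    linarith [hL0 x, hL1 x]
  choose φ h1 h2 h3 h4 using hex
  refine ⟨φ, h3, fun x y hxy ↦ ?_, h4⟩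
  obtain ⟨g1, g2⟩ := leftEnd_of_prefix hp0 hF0 hF1 hxy
  have hpos : 0 < ((φ y).map p).prod := (mul_pos (half_pos hq) (hQ y)).trans_le (h4 y)
  rcases lt_trichotomy (e x) (e y) with h | h | h
  · linarith [hLlt x y h, h1 x, h1 y, h2 x, h2 y]
  · exact he h
  · linarith [hLlt y x h, h1 x, h1 y, h2 x, h2 y]
lemma prod_map_rpow_neg_eq {U : Type*} {k : ℝ} (hk : 0 < k) (α : ℝ) (c : U → ℝ) (s : List U) :
    (s.map fun u ↦ k ^ (-(α * c u))).prod = k ^ (-(α * strCost c s)) := by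
  induction s with
  | nil => simp [strCost]
  | cons u s ih =>
    have : strCost c (u :: s) = c u + strCost c s := by simp [strCost]
    rw [List.map_cons, List.prod_cons, ih, this, ← Real.rpow_add hk]
    ring_nf

/-- The measure on a discrete space with point masses `P`. -/
noncomputable def pointMassMeasure {X : Type*} [MeasurableSpace X] (P : X → ℝ) : Measure X :=
  Measure.sum fun x ↦ ENNReal.ofReal (P x) • Measure.dirac x

lemma pointMassMeasure_singleton {X : Type*} [MeasurableSpace X] [MeasurableSingletonClass X]
    (P : X → ℝ) (x : X) : pointMassMeasure P {x} = ENNReal.ofReal (P x) := by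
  rw [pointMassMeasure, Measure.sum_apply _ (measurableSet_singleton x), tsum_eq_single x]
  · simp
  · intro y hy
    simp [hy]

lemma isProbabilityMeasure_pointMassMeasure {X : Type*} [MeasurableSpace X] {P : X → ℝ}
    (hP0 : ∀ x, 0 ≤ P x) (hP1 : HasSum P 1) : IsProbabilityMeasure (pointMassMeasure P) := by
  refine ⟨?_⟩
  rw [pointMassMeasure, Measure.sum_apply _ MeasurableSet.univ]
  simp only [Measure.smul_apply, measure_univ, smul_eq_mul, mul_one]
  rw [← ENNReal.ofReal_tsum_of_nonneg hP0 hP1.summable, hP1.tsum_eq, ENNReal.ofReal_one]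

lemma integral_pointMassMeasure {X : Type*} [Countable X] [MeasurableSpace X]
    [MeasurableSingletonClass X] {P : X → ℝ} (hP0 : ∀ x, 0 ≤ P x) (f : X → ℝ) :
    ∫ x, f x ∂pointMassMeasure P = ∑' x, P x * f x := by
  rw [pointMassMeasure, integral_sum_dirac fun _ ↦ ENNReal.ofReal_ne_top]
  simp [ENNReal.toReal_ofReal (hP0 _)]

lemma pi_pointMassMeasure_singleton {X ι : Type*} [Fintype ι] [MeasurableSpace X]
    [MeasurableSingletonClass X] {P : X → ℝ} (hP0 : ∀ x, 0 ≤ P x) (hP1 : HasSum P 1) (x : ι → X) :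
    Measure.pi (fun _ : ι ↦ pointMassMeasure P) {x} = ENNReal.ofReal (∏ i, P (x i)) := by
  have := isProbabilityMeasure_pointMassMeasure hP0 hP1
  rw [Measure.pi_singleton, ENNReal.ofReal_prod_of_nonneg fun i _ ↦ hP0 _]
  simp [pointMassMeasure_singleton]

lemma prob_eq_measureReal_pi {X ι : Type*} [Countable X] [Fintype ι] [MeasurableSpace X]
    [MeasurableSingletonClass X] {P : X → ℝ} (hP0 : ∀ x, 0 ≤ P x) (hP1 : HasSum P 1)
    (S : Set (ι → X)) :
    prob (fun x : ι → X ↦ ∏ i, P (x i)) S =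
      (Measure.pi (fun _ : ι ↦ pointMassMeasure P)).real S := by
  have := isProbabilityMeasure_pointMassMeasure hP0 hP1
  rw [measureReal_def, ← Measure.tsum_indicator_apply_singleton _ S S.to_countable.measurableSet,
    ENNReal.tsum_toReal_eq]
  · refine tsum_congr fun x ↦ ?_
    by_cases hx : x ∈ S
    · simp only [hx, Set.indicator_of_mem, pi_pointMassMeasure_singleton hP0 hP1]
      rw [ENNReal.toReal_ofReal (Finset.prod_nonneg fun i _ ↦ hP0 _)]
    · simp [hx]
  · intro x
    by_cases hx : x ∈ S <;> simp [hx, -Measure.pi_singleton]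

lemma hasSum_prod_pi {X ι : Type*} [Countable X] [Fintype ι] {P : X → ℝ}
    (hP0 : ∀ x, 0 ≤ P x) (hP1 : HasSum P 1) :
    HasSum (fun x : ι → X ↦ ∏ i, P (x i)) 1 := by
  let _ : MeasurableSpace X := ⊤
  have := isProbabilityMeasure_pointMassMeasure hP0 hP1
  have h := prob_eq_measureReal_pi (ι := ι) hP0 hP1 Set.univ
  rw [prob, Set.indicator_univ, probReal_univ] at h
  rw [← h]
  refine Summable.hasSum ?_
  by_contra hs
  rw [tsum_eq_zero_of_not_summable hs] at h
  exact zero_ne_one h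

/-- Central limit theorem for sums over the letters of a random string. -/
lemma tendsto_prob_lt_inv_sqrt_mul_sum {X : Type*} [Countable X] {P : X → ℝ}
    (hP0 : ∀ x, 0 ≤ P x) (hP1 : HasSum P 1) {g : X → ℝ} (hg : HasSum (fun x ↦ P x * g x) 0)
    (hg2 : HasSum (fun x ↦ P x * g x ^ 2) 1) (a : ℝ) :
    Filter.Tendsto (fun n : ℕ ↦ prob (fun x : Fin n → X ↦ ∏ i, P (x i))
        {x | a < (√(n : ℝ))⁻¹ * ∑ i, g (x i)})
      Filter.atTop (nhds ((gaussianReal 0 1).real (Set.Ioi a))) := by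
  let _ : MeasurableSpace X := ⊤
  have := isProbabilityMeasure_pointMassMeasure hP0 hP1
  have hmg : Measurable g := measurable_from_top
  let ν := Measure.infinitePi fun _ : ℕ ↦ pointMassMeasure P
  have hev : ∀ i, ν.map (fun ω ↦ ω i) = pointMassMeasure P := fun i ↦
    Measure.infinitePi_map_eval _ i
  have hint : ∀ f : X → ℝ, ∫ ω, f (ω 0) ∂ν = ∑' x, P x * f x := fun f ↦ by
    rw [← integral_pointMassMeasure hP0, ← hev 0,
      integral_map (measurable_pi_apply 0).aemeasurable]
    exact (measurable_from_top (f := f)).aestronglyMeasurable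
  have hclt := tendstoInDistribution_inv_sqrt_mul_sum (P := ν) (P' := gaussianReal 0 1)
    (X := fun i ω ↦ g (ω i)) (Y := id) ⟨by fun_prop, by simp⟩
    ((hint g).trans hg.tsum_eq) ((hint (g ^ 2)).trans hg2.tsum_eq)
    (iIndepFun_infinitePi fun _ ↦ hmg)
    (fun i ↦ IdentDistrib.comp (f := fun ω : ℕ → X ↦ ω i) (g := fun ω : ℕ → X ↦ ω 0)
      ⟨(measurable_pi_apply i).aemeasurable, (measurable_pi_apply 0).aemeasurable,
        by rw [hev, hev]⟩ hmg)
  have := nullSingletonClass_gaussianReal (μ := 0) (v := 1) one_ne_zero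
  have h := ProbabilityMeasure.tendsto_measure_of_null_frontier_of_tendsto' hclt.tendsto
    (E := Set.Ioi a) (by simp)
  simp only [ProbabilityMeasure.coe_mk, Measure.map_id] at h
  have h' := (ENNReal.tendsto_toReal (measure_ne_top _ _)).comp h
  refine h'.congr fun n ↦ ?_
  simp only [Function.comp_apply]
  rw [prob_eq_measureReal_pi hP0 hP1, ← Measure.infinitePi_eq_pi (ι := Fin n),
    ← Measure.map_infinitePi_infinitePi_of_inj (P := fun _ : ℕ ↦ pointMassMeasure P)
      (Fin.val_injective (n := n)), measureReal_def,
    Measure.map_apply (by fun_prop) measurableSet_Ioi,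
    Measure.map_apply (by fun_prop) (Set.to_countable _).measurableSet]
  congr 2
  ext ω
  simp [Fin.sum_univ_eq_sum_range (fun i ↦ g (ω i))]

lemma stdGaussianCDF_eq (T : ℝ) :
    stdGaussianCDF T = 1 - (gaussianReal 0 1).real (Set.Ioi T) := by
  have h : stdGaussianCDF T = (gaussianReal 0 1).real (Set.Iic T) := by
    rw [measureReal_def, gaussianReal_apply_eq_integral _ one_ne_zero,
      ENNReal.toReal_ofReal (setIntegral_nonneg measurableSet_Iic
        fun x _ ↦ gaussianPDFReal_nonneg _ _ _), stdGaussianCDF]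
    simp [gaussianPDFReal]
  rw [h, ← Set.compl_Iic, probReal_compl_eq_one_sub measurableSet_Iic]
  ring

lemma gaussianReal_Ioi_strictAnti : StrictAnti fun a ↦ (gaussianReal 0 1).real (Set.Ioi a) := by
  intro a b hab
  have h : Set.Ioi a = Set.Ioc a b ∪ Set.Ioi b := (Set.Ioc_union_Ioi_eq_Ioi hab.le).symm
  have hd : Disjoint (Set.Ioc a b) (Set.Ioi b) := Set.disjoint_left.2 fun x hx hx' ↦
    hx.2.not_gt hx'
  simp only
  rw [h, measureReal_union hd measurableSet_Ioi]
  have hpos : 0 < (gaussianReal 0 1).real (Set.Ioc a b) := by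
    rw [measureReal_def, ENNReal.toReal_pos_iff]
    refine ⟨pos_iff_ne_zero.2 fun h0 ↦ ?_, measure_lt_top _ _⟩
    have := gaussianReal_absolutelyContinuous' 0 one_ne_zero h0
    simp [hab.not_ge] at this
  linarith

section Prob

variable {X : Type*} {Q : X → ℝ}

lemma prob_nonneg (hQ0 : ∀ x, 0 ≤ Q x) (S : Set X) : 0 ≤ prob Q S :=
  tsum_nonneg fun _ ↦ Set.indicator_nonneg (fun _ _ ↦ hQ0 _) _

lemma prob_le_prob_add_prob (hQ0 : ∀ x, 0 ≤ Q x) (hQs : Summable Q) {S A B : Set X}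
    (h : ∀ x, 0 < Q x → x ∈ S → x ∈ A ∨ x ∈ B) : prob Q S ≤ prob Q A + prob Q B := by
  rw [prob, prob, prob, ← (hQs.indicator _).tsum_add (hQs.indicator _)]
  refine (hQs.indicator _).tsum_le_tsum (fun x ↦ ?_) ((hQs.indicator _).add (hQs.indicator _))
  have hA := Set.indicator_nonneg (s := A) (fun x _ ↦ hQ0 x) x
  have hB := Set.indicator_nonneg (s := B) (fun x _ ↦ hQ0 x) x
  by_cases hx : x ∈ S
  · rcases (hQ0 x).eq_or_lt with h0 | h0
    · simp only [hx, Set.indicator_of_mem, ← h0]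
      linarith
    · rcases h x h0 hx with h1 | h1
      · simpa [hx, h1] using hB
      · simpa [hx, h1] using hA
  · simp only [hx, not_false_eq_true, Set.indicator_of_notMem]
    linarith

lemma prob_mono (hQ0 : ∀ x, 0 ≤ Q x) (hQs : Summable Q) {S A : Set X}
    (h : ∀ x, 0 < Q x → x ∈ S → x ∈ A) : prob Q S ≤ prob Q A := by
  simpa [prob] using prob_le_prob_add_prob (B := ∅) hQ0 hQs fun x h0 hx ↦ Or.inl (h x h0 hx)

lemma prob_le_of_prefix_code {U : Type*} [Fintype U] {p : U → ℝ} (hp0 : ∀ u, 0 ≤ p u)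
    (hp1 : ∑ u, p u ≤ 1) (hQ0 : ∀ x, 0 ≤ Q x) {φ : X → List U} (hinj : Function.Injective φ)
    (hφ : ∀ x y, φ x <+: φ y → φ x = φ y) {η : ℝ} (hη : 0 ≤ η) :
    prob Q {x | Q x ≤ η * ((φ x).map p).prod} ≤ η := by
  classical
  refine Real.tsum_le_of_sum_le (fun _ ↦ Set.indicator_nonneg (fun _ _ ↦ hQ0 _) _) fun A ↦ ?_
  calc _ ≤ ∑ x ∈ A, η * ((φ x).map p).prod := by
        refine Finset.sum_le_sum fun x _ ↦ Set.indicator_le' (fun y hy ↦ hy) (fun y _ ↦ ?_) x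
        exact mul_nonneg hη (prod_map_nonneg hp0 _)
    _ = η * ∑ s ∈ A.image φ, (s.map p).prod := by
        rw [Finset.sum_image hinj.injOn, Finset.mul_sum]
    _ ≤ η := by
        refine mul_le_of_le_one_right hη (kraft_finset hp0 hp1 ((A.image φ).sup List.length) _
          (fun s hs ↦ Finset.le_sup (f := List.length) hs) ?_)
        simp only [Finset.forall_mem_image]
        exact fun x _ y _ ↦ hφ x y

end Prob

/-- A prefix code with word weights within a constant factor of any nonnegative, possibly
vanishing, mass function. -/
lemma exists_prefix_code_of_nonneg {U X : Type*} [Fintype U] [Countable X] {p : U → ℝ} {q r : ℝ}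
    (hq : 0 < q) (hqp : ∀ u, q ≤ p u) (hpr : ∀ u, p u ≤ r) (hr : r < 1) (hp1 : ∑ u, p u = 1)
    {Q : X → ℝ} (hQ0 : ∀ x, 0 ≤ Q x) (hQ1 : HasSum Q 1) :
    ∃ φ : X → List U, (∀ x, φ x ≠ []) ∧ (∀ x y, φ x <+: φ y → x = y) ∧
      ∀ x, q / 4 * Q x ≤ ((φ x).map p).prod := by
  have := Encodable.ofCountable X
  obtain ⟨R, hR, s, hRs, hs⟩ := posSumOfEncodable (one_half_pos (α := ℝ)) X
  have hsum := (hQ1.div_const 2).add hRs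
  obtain ⟨φ, h1, h2, h3⟩ := exists_prefix_code hq hqp hpr hr hp1 (Q := fun x ↦ Q x / 2 + R x)
    (fun x ↦ by linarith [hQ0 x, hR x]) hsum.summable (by rw [hsum.tsum_eq]; linarith)
  refine ⟨φ, h1, h2, fun x ↦ le_trans ?_ (h3 x)⟩
  have := mul_pos hq (hR x)
  linarith

lemma logb_inv_prod {X ι : Type*} [Fintype ι] (k : ℝ) {P : X → ℝ} {x : ι → X}
    (h : ∏ i, P (x i) ≠ 0) :
    ∑ i, Real.logb k (P (x i))⁻¹ = -Real.logb k (∏ i, P (x i)) := by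
  rw [Real.logb_prod _ _ fun i _ hi ↦ h (Finset.prod_eq_zero (Finset.mem_univ i) hi)]
  simp [Real.logb_inv]

lemma lt_inv_sqrt_mul_sum_iff {X : Type*} {P : X → ℝ} {n : ℕ} (hn : 0 < n) {σ : ℝ} (hσ : 0 < σ)
    (k H a : ℝ) {x : Fin n → X} (h : ∏ i, P (x i) ≠ 0) :
    a < (√(n : ℝ))⁻¹ * ∑ i, (Real.logb k (P (x i))⁻¹ - H) / σ ↔
      n * H + a * σ * √(n : ℝ) < -Real.logb k (∏ i, P (x i)) := by
  have hs : 0 < √(n : ℝ) := Real.sqrt_pos.2 (by exact_mod_cast hn)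
  rw [← Finset.sum_div, Finset.sum_sub_distrib, logb_inv_prod k h, lt_inv_mul_iff₀ hs,
    lt_div_iff₀ hσ]
  simp only [Finset.sum_const, Finset.card_univ, Fintype.card_fin, nsmul_eq_mul]
  constructor <;> intro h <;> linarith

lemma eventually_le_mul_sqrt (C : ℝ) {d : ℝ} (hd : 0 < d) :
    ∀ᶠ n : ℕ in Filter.atTop, 0 < n ∧ C ≤ d * √(n : ℝ) := by
  have h : Filter.Tendsto (fun n : ℕ ↦ d * √(n : ℝ)) Filter.atTop Filter.atTop :=
    (Real.tendsto_sqrt_atTop.comp tendsto_natCast_atTop_atTop).const_mul_atTop hd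
  exact (Filter.eventually_gt_atTop 0).and (h.eventually_ge_atTop C)

/-- For an i.i.d. source, the infimum of (ε, H(X)/α_c)-achievable second-order overflow
thresholds is `(σ/α_c)·Φ⁻¹(1−ε)`. -/
theorem second_order_iid {U 𝒳 : Type*} [Fintype U] [Countable 𝒳]
    (K : ℕ) (hK : 2 ≤ K) (hcard : Fintype.card U = K)
    (c : U → ℝ) (hc : ∀ u, 0 < c u)
    (α : ℝ) (hα : 0 < α) (hroot : ∑ u : U, (K : ℝ) ^ (-(α * c u)) = 1)
    (P : 𝒳 → ℝ) (hP0 : ∀ x, 0 ≤ P x) (hP1 : HasSum P 1)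
    (H : ℝ) (hH : HasSum (fun x => P x * Real.logb K (P x)⁻¹) H)
    (σ : ℝ) (hσ : 0 < σ)
    (hvar : HasSum (fun x => P x * (Real.logb K (P x)⁻¹ - H) ^ 2) (σ ^ 2))
    (ε : ℝ) (hε0 : 0 < ε) (hε1 : ε < 1)
    (T : ℝ) (hT : stdGaussianCDF T = 1 - ε) :
    sInf {L : ℝ | ∃ φ : ∀ n, (Fin n → 𝒳) → List U,
        (∀ n, Function.Injective (φ n)) ∧ (∀ n x, φ n x ≠ []) ∧
        (∀ n x y, φ n x <+: φ n y → φ n x = φ n y) ∧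
        Filter.limsup
          (fun n => prob (fun x : Fin n → 𝒳 => ∏ i, P (x i))
            {x | (n : ℝ) * (H / α) + L * Real.sqrt n < strCost c (φ n x)})
          Filter.atTop ≤ ε}
      = (σ / α) * T := by
  have hk1 : (1 : ℝ) < K := by exact_mod_cast hK
  have hk0 : (0 : ℝ) < K := by linarith
  let p : U → ℝ := fun u ↦ (K : ℝ) ^ (-(α * c u))
  have hp0 : ∀ u, 0 < p u := fun u ↦ Real.rpow_pos_of_pos hk0 _
  have hplt : ∀ u, p u < 1 := fun u ↦
    Real.rpow_lt_one_of_one_lt_of_neg hk1 (neg_neg_of_pos (mul_pos hα (hc u)))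
  have : Nonempty U := Fintype.card_pos_iff.1 (by omega)
  obtain ⟨u₀, hu₀⟩ := Finite.exists_min p
  obtain ⟨u₁, hu₁⟩ := Finite.exists_max p
  have hPn0 : ∀ n (x : Fin n → 𝒳), 0 ≤ ∏ i, P (x i) := fun n x ↦
    Finset.prod_nonneg fun i _ ↦ hP0 _
  have hPn1 : ∀ n, HasSum (fun x : Fin n → 𝒳 ↦ ∏ i, P (x i)) 1 := fun n ↦ hasSum_prod_pi hP0 hP1
  let g : 𝒳 → ℝ := fun x ↦ (Real.logb K (P x)⁻¹ - H) / σ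
  have hg : HasSum (fun x ↦ P x * g x) 0 := by
    convert! (hH.sub (hP1.mul_right H)).div_const σ using 1
    · ext x; simp only [g]; ring
    · simp
  have hg2 : HasSum (fun x ↦ P x * g x ^ 2) 1 := by
    convert! hvar.div_const (σ ^ 2) using 1
    · ext x; simp only [g]; ring
    · field_simp
  have hclt := tendsto_prob_lt_inv_sqrt_mul_sum hP0 hP1 hg hg2
  have hGT : (gaussianReal 0 1).real (Set.Ioi T) = ε := by
    linarith [hT, stdGaussianCDF_eq T]
  have hprobc : ∀ (S : ∀ n, Set (Fin n → 𝒳)), Filter.IsCoboundedUnder (· ≤ ·) Filter.atTop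
      (fun n ↦ prob (fun x : Fin n → 𝒳 ↦ ∏ i, P (x i)) (S n)) := fun S ↦
    (Filter.isBoundedUnder_of ⟨0, fun n ↦ prob_nonneg (hPn0 n) _⟩ :
      Filter.IsBoundedUnder (· ≥ ·) _ _).isCoboundedUnder_le
  have hprobb : ∀ (S : ∀ n, Set (Fin n → 𝒳)), Filter.IsBoundedUnder (· ≤ ·) Filter.atTop
      (fun n ↦ prob (fun x : Fin n → 𝒳 ↦ ∏ i, P (x i)) (S n)) := fun S ↦
    Filter.isBoundedUnder_of ⟨1, fun n ↦ by
      refine (prob_mono (A := Set.univ) (hPn0 n) (hPn1 n).summable (by simp)).trans ?_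
      rw [prob, Set.indicator_univ, (hPn1 n).tsum_eq]⟩
  have hachieve : ∀ L, σ / α * T < L → ∃ φ : ∀ n, (Fin n → 𝒳) → List U,
      (∀ n, Function.Injective (φ n)) ∧ (∀ n x, φ n x ≠ []) ∧
      (∀ n x y, φ n x <+: φ n y → φ n x = φ n y) ∧
      Filter.limsup (fun n => prob (fun x : Fin n → 𝒳 => ∏ i, P (x i))
        {x | (n : ℝ) * (H / α) + L * Real.sqrt n < strCost c (φ n x)}) Filter.atTop ≤ ε := by
    intro L hL
    have hL' : 0 < α * L - T * σ := by
      rw [div_mul_eq_mul_div, div_lt_iff₀ hα] at hL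
      linarith
    choose φ h1 h2 h3 using fun n ↦
      exists_prefix_code_of_nonneg (hp0 u₀) hu₀ hu₁ (hplt u₁) hroot (hPn0 n) (hPn1 n)
    refine ⟨φ, fun n x y hxy ↦ h2 n x y (hxy ▸ List.prefix_rfl), h1,
      fun n x y hxy ↦ congrArg (φ n) (h2 n x y hxy), ?_⟩
    rw [← hGT, ← (hclt T).limsup_eq]
    refine Filter.limsup_le_limsup ?_ (hprobc _) (hprobb _)
    filter_upwards [eventually_le_mul_sqrt (-Real.logb K (p u₀ / 4)) hL'] with n hn
    refine prob_mono (hPn0 n) (hPn1 n).summable fun x hx hmem ↦ ?_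
    refine (lt_inv_sqrt_mul_sum_iff hn.1 hσ _ _ _ hx.ne').2 ?_
    have hcost := h3 n x
    have hq4 : 0 < p u₀ / 4 := by linarith [hp0 u₀]
    rw [prod_map_rpow_neg_eq hk0, ← Real.logb_le_iff_le_rpow hk1 (mul_pos hq4 hx),
      Real.logb_mul hq4.ne' hx.ne'] at hcost
    have hmem' := mul_lt_mul_of_pos_left hmem.out hα
    have : α * (n * (H / α) + L * √(n : ℝ)) = n * H + α * L * √(n : ℝ) := by field_simp
    linarith [hn.2]
  refine csInf_eq_of_forall_ge_of_forall_gt_exists_lt ⟨σ / α * T + 1, hachieve _ (by linarith)⟩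
    ?_ fun w hw ↦ ?_
  · rintro L ⟨φ, hinj, -, hpre, hlim⟩
    by_contra! hL
    have hLT : α * L / σ < T := by
      rw [div_mul_eq_mul_div, lt_div_iff₀ hα] at hL
      rw [div_lt_iff₀ hσ]
      linarith
    obtain ⟨a, ha1, haT⟩ := exists_between hLT
    have ha : 0 < a * σ - α * L := by
      rw [div_lt_iff₀ hσ] at ha1
      linarith
    have hGa := gaussianReal_Ioi_strictAnti haT
    simp only [hGT] at hGa
    obtain ⟨η, hη⟩ : ∃ η, η = ((gaussianReal 0 1).real (Set.Ioi a) - ε) / 2 := ⟨_, rfl⟩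
    have hη0 : 0 < η := by linarith
    have hle : (gaussianReal 0 1).real (Set.Ioi a) - η ≤ ε := by
      rw [← ((hclt a).sub_const η).limsup_eq]
      refine le_trans (Filter.limsup_le_limsup ?_
        ((hclt a).sub_const η).isCoboundedUnder_le (hprobb _)) hlim
      filter_upwards [eventually_le_mul_sqrt (-Real.logb K η) ha] with n hn
      have hB := prob_le_of_prefix_code (fun u ↦ (hp0 u).le) hroot.le (hPn0 n) (hinj n) (hpre n)
        hη0.le
      refine sub_le_iff_le_add.2 ((prob_le_prob_add_prob (hPn0 n) (hPn1 n).summable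
        fun x hx hmem ↦ ?_).trans (add_le_add_right hB _))
      refine or_iff_not_imp_left.2 fun hnot ↦ ?_
      have hmem' := (lt_inv_sqrt_mul_sum_iff hn.1 hσ _ _ _ hx.ne').1 hmem
      have hnot' := mul_le_mul_of_nonneg_left (not_lt.1 hnot) hα.le
      have : α * (n * (H / α) + L * √(n : ℝ)) = n * H + α * L * √(n : ℝ) := by field_simp
      have hw : 0 < (K : ℝ) ^ (-(α * strCost c (φ n x))) := Real.rpow_pos_of_pos hk0 _
      simp only [Set.mem_ofPred_eq]
      rw [prod_map_rpow_neg_eq hk0, ← Real.logb_le_logb hk1 hx (mul_pos hη0 hw),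
        Real.logb_mul hη0.ne' hw.ne', Real.logb_rpow hk0 hk1.ne']
      linarith [hn.2]
    linarith
  · obtain ⟨L, hL1, hL2⟩ := exists_between hw
    exact ⟨L, hachieve L hL1, hL2⟩
end

section
/- Let X be the mixture with weights w(1), w(2) > 0 of two i.i.d. sources X₁, X₂ with equal entropies H(X₁) = H(X₂) = H and finite positive self-information variances σ₁², σ₂². Then for 0 < ε < 1 with ε ≠ w(1), the infimum of (ε, H/α_c)-achievable second-order overflow thresholds is the unique T₁ satisfying ε = 1 − w(1)Φ(T₁α_c/σ₁) − w(2)Φ(T₁α_c/σ₂), where Φ is the standard normal CDF. -/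
open MeasureTheory ProbabilityTheory Filter Topology

/-! ### The standard Gaussian distribution function -/

lemma stdGaussianCDF_eq_measureReal (t : ℝ) :
    stdGaussianCDF t = (gaussianReal 0 1).real (Set.Iic t) := by
  have h0 : 0 ≤ ∫ x in Set.Iic t, gaussianPDFReal 0 1 x :=
    integral_nonneg fun x => gaussianPDFReal_nonneg _ _ _
  rw [measureReal_def, gaussianReal_apply_eq_integral _ one_ne_zero, ENNReal.toReal_ofReal h0]
  simp [stdGaussianCDF, gaussianPDFReal_def]

lemma measureReal_gaussianReal_Ioi (t : ℝ) :
    (gaussianReal 0 1).real (Set.Ioi t) = 1 - stdGaussianCDF t := by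
  rw [← Set.compl_Iic, probReal_compl_eq_one_sub measurableSet_Iic, stdGaussianCDF_eq_measureReal]

lemma strictMono_stdGaussianCDF : StrictMono stdGaussianCDF := by
  intro s t hst
  rw [stdGaussianCDF_eq_measureReal, stdGaussianCDF_eq_measureReal,
    ← Set.Iic_union_Ioc_eq_Iic hst.le,
    measureReal_union (Set.Iic_disjoint_Ioc le_rfl) measurableSet_Ioc]
  have hpos : 0 < (gaussianReal 0 1).real (Set.Ioc s t) := by
    refine ENNReal.toReal_pos (fun h => ?_) (measure_ne_top _ _)
    have := gaussianReal_absolutelyContinuous' 0 (one_ne_zero) h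
    simp [hst.not_ge] at this
  linarith

/-! ### Discrete distributions -/

/-- The measure on a discrete space with a given real-valued mass function. -/
noncomputable def massMeasure {Y : Type*} [MeasurableSpace Y] (P : Y → ℝ) : Measure Y :=
  Measure.sum fun y => ENNReal.ofReal (P y) • Measure.dirac y

section massMeasure

variable {Y : Type*} [MeasurableSpace Y] {P : Y → ℝ}

lemma massMeasure_singleton [MeasurableSingletonClass Y] (P : Y → ℝ) (y : Y) : massMeasure P {y} = ENNReal.ofReal (P y) := by
  classical
  rw [massMeasure, Measure.sum_apply _ (measurableSet_singleton y), tsum_eq_single y]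
  · simp
  · intro z hz
    simp [hz]

lemma isProbabilityMeasure_massMeasure (h0 : ∀ y, 0 ≤ P y) (h1 : HasSum P 1) :
    IsProbabilityMeasure (massMeasure P) := by
  constructor
  rw [massMeasure, Measure.sum_apply _ MeasurableSet.univ]
  simp [← ENNReal.ofReal_tsum_of_nonneg h0 h1.summable, h1.tsum_eq]

lemma integrable_massMeasure [Countable Y] [MeasurableSingletonClass Y] (h0 : ∀ y, 0 ≤ P y) {f : Y → ℝ}
    (hf : Summable fun y => P y * f y) : Integrable f (massMeasure P) := by
  refine integrable_sum_dirac (by simp) ?_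
  refine hf.abs.congr fun y => ?_
  rw [ENNReal.toReal_ofReal (h0 y), abs_mul, abs_of_nonneg (h0 y), Real.norm_eq_abs]

lemma integral_massMeasure [Countable Y] [MeasurableSingletonClass Y] (h0 : ∀ y, 0 ≤ P y) {f : Y → ℝ} {s : ℝ}
    (hf : HasSum (fun y => P y * f y) s) : ∫ y, f y ∂massMeasure P = s := by
  have hi : Summable fun y => (ENNReal.ofReal (P y)).toReal * ‖f y‖ :=
    (integrable_massMeasure h0 hf.summable).summable_of_dirac
  have := hasSum_integral_sum_dirac (E := ℝ) (x := fun y : Y => y) (f := f)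
    (c := fun y => ENNReal.ofReal (P y)) (by simp) hi
  refine this.unique ?_
  simpa [ENNReal.toReal_ofReal (h0 _)] using hf

lemma measureReal_eq_prob [Countable Y] [MeasurableSingletonClass Y] (ν : Measure Y) [IsFiniteMeasure ν] (S : Set Y) :
    ν.real S = prob (fun y => ν.real {y}) S := by
  rw [measureReal_def, ← Measure.tsum_indicator_apply_singleton ν S (Set.to_countable S).measurableSet,
    ENNReal.tsum_toReal_eq]
  · refine tsum_congr fun y => ?_
    by_cases hy : y ∈ S <;> simp [hy, measureReal_def]
  · intro y
    by_cases hy : y ∈ S <;> simp [hy]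

end massMeasure

lemma hasSum_prod_one {𝒳 : Type*} [Countable 𝒳] {P : 𝒳 → ℝ} (h0 : ∀ x, 0 ≤ P x)
    (h1 : HasSum P 1) (n : ℕ) : HasSum (fun x : Fin n → 𝒳 => ∏ i, P (x i)) 1 := by
  let _ : MeasurableSpace 𝒳 := ⊤
  have := isProbabilityMeasure_massMeasure h0 h1
  have hsing (x : Fin n → 𝒳) :
      Measure.infinitePi (fun _ : Fin n => massMeasure P) {x} = ENNReal.ofReal (∏ i, P (x i)) := by
    rw [Measure.infinitePi_singleton_of_fintype, ENNReal.ofReal_prod_of_nonneg fun i _ => h0 _]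
    simp [massMeasure_singleton]
  have hs := Measure.tsum_indicator_apply_singleton
    (Measure.infinitePi fun _ : Fin n => massMeasure P) Set.univ MeasurableSet.univ
  simp only [Set.indicator_univ, hsing, measure_univ] at hs
  have hp (x : Fin n → 𝒳) : 0 ≤ ∏ i, P (x i) := Finset.prod_nonneg fun i _ => h0 _
  have h2 := ENNReal.hasSum_toReal (f := fun x : Fin n → 𝒳 => ENNReal.ofReal (∏ i, P (x i)))
    (by simp [hs])
  rw [← ENNReal.tsum_toReal_eq (by simp), hs] at h2
  simpa [ENNReal.toReal_ofReal (hp _)] using h2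

lemma measureReal_infinitePi_eq_prob {𝒳 : Type*} [Countable 𝒳] [MeasurableSpace 𝒳]
    [MeasurableSingletonClass 𝒳] {P : 𝒳 → ℝ} (h0 : ∀ x, 0 ≤ P x)
    [IsProbabilityMeasure (massMeasure P)] (n : ℕ) (S : Set (Fin n → 𝒳)) :
    (Measure.infinitePi fun _ : ℕ => massMeasure P).real {ω | (fun i : Fin n => ω i) ∈ S} =
      prob (fun x : Fin n → 𝒳 => ∏ i, P (x i)) S := by
  have hmap := Measure.map_infinitePi_infinitePi_of_inj (P := fun _ : ℕ => massMeasure P)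
    (f := fun i : Fin n => (i : ℕ)) Fin.val_injective
  have hS : MeasurableSet S := (Set.to_countable S).measurableSet
  have : (Measure.infinitePi fun _ : ℕ => massMeasure P).real {ω | (fun i : Fin n => ω i) ∈ S} =
      (Measure.infinitePi fun _ : Fin n => massMeasure P).real S := by
    rw [← hmap, measureReal_def, measureReal_def, Measure.map_apply (by fun_prop) hS]
    rfl
  rw [this, measureReal_eq_prob]
  congr 1
  ext x
  rw [measureReal_def, Measure.infinitePi_singleton_of_fintype, ENNReal.toReal_prod]
  simp [massMeasure_singleton, ENNReal.toReal_ofReal (h0 _)]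

/-- The central limit theorem for the tail of a sum over an i.i.d. discrete source. -/
lemma tendsto_prob_sum_gt {𝒳 : Type*} [Countable 𝒳] {P : 𝒳 → ℝ} (h0 : ∀ x, 0 ≤ P x)
    (h1 : HasSum P 1) {f : 𝒳 → ℝ} {H σ : ℝ} (hσ : 0 < σ)
    (hmean : HasSum (fun x => P x * f x) H)
    (hvar : HasSum (fun x => P x * (f x - H) ^ 2) (σ ^ 2)) (a : ℝ) :
    Tendsto (fun n : ℕ => prob (fun x : Fin n → 𝒳 => ∏ i, P (x i))
      {x | (n : ℝ) * H + a * √n < ∑ i, f (x i)}) atTop (𝓝 (1 - stdGaussianCDF (a / σ))) := by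
  let _ : MeasurableSpace 𝒳 := ⊤
  have := isProbabilityMeasure_massMeasure h0 h1
  set Q := Measure.infinitePi fun _ : ℕ => massMeasure P
  let g : 𝒳 → ℝ := fun x => (f x - H) / σ
  have hg : Measurable g := measurable_from_top
  let X : ℕ → (ℕ → 𝒳) → ℝ := fun k ω => g (ω k)
  have hXm (k : ℕ) : Measurable (X k) := hg.comp (measurable_pi_apply k)
  have hint (k : ℕ) (h : 𝒳 → ℝ) : ∫ ω, h (ω k) ∂Q = ∫ x, h x ∂massMeasure P := by
    have hmk := Measure.infinitePi_map_eval (fun _ : ℕ => massMeasure P) k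
    rw [← hmk, integral_map (measurable_pi_apply k).aemeasurable
      (Measurable.aestronglyMeasurable measurable_from_top)]
  have hX0 : Q[X 0] = 0 := by
    rw [hint 0 g]
    refine integral_massMeasure h0 ?_
    have := (hmean.sub (h1.mul_right H)).div_const σ
    convert! this using 1
    · ext x; simp only [g]; ring
    · ring
  have hX1 : Q[X 0 ^ 2] = 1 := by
    refine (hint 0 fun x => g x ^ 2).trans ?_
    refine integral_massMeasure h0 ?_
    have := hvar.div_const (σ ^ 2)
    convert! this using 1
    · ext x; simp only [g]; ring
    · rw [div_self (by positivity)]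
  have hindep : iIndepFun X Q :=
    iIndepFun_infinitePi (P := fun _ : ℕ => massMeasure P) (X := fun _ => g) fun _ => hg
  have hident (k : ℕ) : IdentDistrib (X k) (X 0) Q Q := by
    refine ⟨(hXm k).aemeasurable, (hXm 0).aemeasurable, ?_⟩
    have (j : ℕ) : Q.map (X j) = (massMeasure P).map g := by
      rw [← Measure.infinitePi_map_eval (fun _ : ℕ => massMeasure P) j,
        Measure.map_map hg (measurable_pi_apply j)]
      rfl
    rw [this, this]
  have hclt := (tendstoInDistribution_inv_sqrt_mul_sum (P' := gaussianReal 0 1)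
    (Y := id) ⟨aemeasurable_id, Measure.map_id⟩ hX0 hX1 hindep hident).tendsto
  have hlim := ProbabilityMeasure.tendsto_measure_of_null_frontier_of_tendsto hclt
    (E := Set.Ioi (a / σ)) (by
      have := nullSingletonClass_gaussianReal (μ := 0) (v := 1) one_ne_zero
      rw [frontier_Ioi, ← ENNReal.coe_eq_zero]
      simp)
  have hlim' := (NNReal.continuous_coe.tendsto _).comp hlim
  rw [← measureReal_gaussianReal_Ioi, ← Measure.map_id (μ := gaussianReal 0 1)]
  refine hlim'.congr' ?_
  filter_upwards [eventually_gt_atTop 0] with n hn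
  have hn' : (0 : ℝ) < √n := by positivity
  have hmeas : Measurable fun ω => (√(n : ℝ))⁻¹ * ∑ k ∈ Finset.range n, X k ω := by fun_prop
  rw [← measureReal_infinitePi_eq_prob h0]
  change (Q.map _).real _ = Q.real _
  rw [measureReal_def, measureReal_def, Measure.map_apply hmeas measurableSet_Ioi]
  congr 2
  ext ω
  have hsum : ∑ k ∈ Finset.range n, X k ω = (∑ i : Fin n, f (ω i) - n * H) / σ := by
    rw [Finset.sum_range]
    simp only [X, g, ← Finset.sum_div, Finset.sum_sub_distrib]
    simp
  have hkey : a / σ < (√(n : ℝ))⁻¹ * ((∑ i : Fin n, f (ω i) - n * H) / σ) ↔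
      (n : ℝ) * H + a * √n < ∑ i : Fin n, f (ω i) := by
    rw [show (√(n : ℝ))⁻¹ * ((∑ i : Fin n, f (ω i) - n * H) / σ) =
      ((∑ i : Fin n, f (ω i) - n * H) / √n) / σ by ring, div_lt_div_iff_of_pos_right hσ,
      lt_div_iff₀ hn']
    constructor <;> intro h <;> linarith
  simpa [hsum] using hkey

/-! ### Prefix codes with letter costs -/

lemma strCost_nil {U : Type*} (c : U → ℝ) : strCost c [] = 0 := by simp [strCost]

lemma strCost_cons {U : Type*} (c : U → ℝ) (u : U) (s : List U) :
    strCost c (u :: s) = c u + strCost c s := by simp [strCost]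

/-- Splitting `b ^ (α ℓ)` over the first letter. -/
lemma sum_rpow_sub_eq {U : Type*} [Fintype U] {c : U → ℝ} {b α : ℝ} (hb : 0 < b)
    (hroot : ∑ u, b ^ (-(α * c u)) = 1) (ℓ : ℝ) :
    ∑ u, b ^ (α * (ℓ - c u)) = b ^ (α * ℓ) := by
  calc ∑ u, b ^ (α * (ℓ - c u)) = ∑ u, b ^ (α * ℓ) * b ^ (-(α * c u)) :=
        Finset.sum_congr rfl fun u _ => by rw [← Real.rpow_add hb]; ring_nf
    _ = b ^ (α * ℓ) := by rw [← Finset.mul_sum, hroot, mul_one]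

/-- Kraft-type counting bound: the number of codewords of cost at most `ℓ` in a prefix-free set. -/
lemma card_le_of_prefixFree {U : Type*} [Fintype U] {c : U → ℝ} {b α : ℝ}
    (hb : 1 < b) (hα : 0 < α) (hroot : ∑ u, b ^ (-(α * c u)) = 1) {ℓ : ℝ} {F : Finset (List U)}
    (hpf : ∀ s ∈ F, ∀ t ∈ F, s <+: t → s = t) (hcost : ∀ s ∈ F, strCost c s ≤ ℓ) :
    (F.card : ℝ) ≤ b ^ (α * ℓ) := by
  classical
  have hb0 : 0 < b := by linarith
  obtain ⟨N, hN⟩ : ∃ N, ∀ s ∈ F, s.length < N :=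
    ⟨F.sup List.length + 1, fun s hs => Nat.lt_succ_of_le (Finset.le_sup (f := List.length) hs)⟩
  induction N generalizing F ℓ with
  | zero =>
    have : F = ∅ := Finset.eq_empty_of_forall_notMem fun s hs => absurd (hN s hs) (by simp)
    simp only [this, Finset.card_empty, Nat.cast_zero]
    positivity
  | succ N ih =>
    by_cases hnil : [] ∈ F
    · have hF : F = {[]} := Finset.eq_singleton_iff_unique_mem.2
        ⟨hnil, fun s hs => (hpf [] hnil s hs List.nil_prefix).symm⟩
      have hℓ : 0 ≤ ℓ := by simpa [strCost_nil] using hcost [] hnil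
      simpa [hF] using Real.one_le_rpow hb.le (mul_nonneg hα.le hℓ)
    · let G : U → Finset (List U) := fun u => F.preimage (List.cons u) List.cons_injective.injOn
      have hG (u : U) (s : List U) : s ∈ G u ↔ u :: s ∈ F := Finset.mem_preimage
      have hsub : F ⊆ Finset.univ.biUnion fun u => (G u).image (List.cons u) := by
        intro s hs
        cases s with
        | nil => exact absurd hs hnil
        | cons u s => simp [hG, hs]
      have hcard (u : U) : ((G u).card : ℝ) ≤ b ^ (α * (ℓ - c u)) := by
        refine ih (fun s hs t ht hst => ?_) (fun s hs => ?_) fun s hs => ?_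
        · exact (List.cons.inj (hpf _ ((hG u s).1 hs) _ ((hG u t).1 ht)
            ((List.prefix_cons_inj u).2 hst))).2
        · have := hcost _ ((hG u s).1 hs)
          rw [strCost_cons] at this
          linarith
        · simpa using hN _ ((hG u s).1 hs)
      calc (F.card : ℝ) ≤ ∑ u, ((G u).card : ℝ) := by
            have h := (Finset.card_le_card hsub).trans Finset.card_biUnion_le
            have h' : ∑ u, ((G u).image (List.cons u)).card ≤ ∑ u, (G u).card :=
              Finset.sum_le_sum fun u _ => Finset.card_image_le
            exact_mod_cast h.trans h'
        _ ≤ ∑ u, b ^ (α * (ℓ - c u)) := Finset.sum_le_sum fun u _ => hcard u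
        _ = b ^ (α * ℓ) := sum_rpow_sub_eq hb0 hroot ℓ

/-- A prefix-free set of strings of cost at most `ℓ` that is as large as possible up to a
constant factor. -/
lemma exists_prefixFree_card_ge {U : Type*} [Fintype U] {c : U → ℝ} (hc : ∀ u, 0 < c u) {b α : ℝ}
    (hb : 1 < b) (hα : 0 < α) (hroot : ∑ u, b ^ (-(α * c u)) = 1) {ℓ : ℝ} (hℓ : 0 ≤ ℓ) :
    ∃ T : Finset (List U), (∀ s ∈ T, ∀ t ∈ T, s <+: t → s = t) ∧ (∀ s ∈ T, strCost c s ≤ ℓ) ∧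
      b ^ (α * (ℓ - ∑ u, c u)) ≤ T.card := by
  classical
  have hb0 : 0 < b := by linarith
  set D := ∑ u, c u
  have hD (u : U) : c u ≤ D := Finset.single_le_sum (fun v _ => (hc v).le) (Finset.mem_univ u)
  obtain ⟨δ, hδ, hδc⟩ : ∃ δ > 0, ∀ u, δ ≤ c u := by
    cases isEmpty_or_nonempty U
    · exact ⟨1, one_pos, fun u => isEmptyElim u⟩
    · obtain ⟨v, hv⟩ := Finite.exists_min c
      exact ⟨c v, hc v, hv⟩
  obtain ⟨N, hN⟩ : ∃ N : ℕ, ℓ < N * δ := by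
    obtain ⟨N, hN⟩ := exists_nat_gt (ℓ / δ)
    exact ⟨N, (div_lt_iff₀ hδ).1 hN⟩
  induction N generalizing ℓ with
  | zero => simp only [Nat.cast_zero, zero_mul] at hN; linarith
  | succ N ih =>
    by_cases h : ℓ < D
    · refine ⟨{[]}, by simp, by simpa [strCost_nil] using hℓ, ?_⟩
      simpa using Real.rpow_le_one_of_one_le_of_nonpos hb.le
        (mul_nonpos_of_nonneg_of_nonpos hα.le (by linarith : ℓ - D ≤ 0))
    · push Not at h
      have hstep (u : U) := ih (ℓ := ℓ - c u) (by linarith [hD u]) (by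
        push_cast at hN
        linarith [hδc u])
      choose T hpf hcost hcard using hstep
      refine ⟨Finset.univ.biUnion fun u => (T u).image (List.cons u), ?_, ?_, ?_⟩
      · intro s hs t ht hst
        simp only [Finset.mem_biUnion, Finset.mem_univ, Finset.mem_image, true_and] at hs ht
        obtain ⟨u, s, hs, rfl⟩ := hs
        obtain ⟨v, t, ht, rfl⟩ := ht
        obtain ⟨rfl, hst'⟩ := List.cons_prefix_cons.1 hst
        rw [hpf u s hs t ht hst']
      · intro s hs
        simp only [Finset.mem_biUnion, Finset.mem_univ, Finset.mem_image, true_and] at hs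
        obtain ⟨u, s, hs, rfl⟩ := hs
        rw [strCost_cons]
        linarith [hcost u s hs]
      · rw [Finset.card_biUnion]
        · simp only [Finset.card_image_of_injective _ List.cons_injective, Nat.cast_sum]
          rw [← sum_rpow_sub_eq hb0 hroot]
          refine Finset.sum_le_sum fun u _ => le_trans (le_of_eq ?_) (hcard u)
          ring_nf
        · intro u _ v _ huv
          simp only [Finset.disjoint_left, Finset.mem_image]
          rintro _ ⟨s, -, rfl⟩ ⟨t, -, h⟩
          exact huv (List.cons.inj h).1.symm

/-- Every countable set has a prefix code over an alphabet with at least two letters. -/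
lemma exists_prefixCode {U Y : Type*} [Nontrivial U] [Countable Y] :
    ∃ f : Y → List U, (∀ y, f y ≠ []) ∧ ∀ y z, f y <+: f z → y = z := by
  obtain ⟨u, v, huv⟩ := exists_pair_ne U
  obtain ⟨e, he⟩ := exists_injective_nat Y
  refine ⟨fun y => List.replicate (e y) u ++ [v], by simp, fun y z h => he ?_⟩
  have key : ∀ m n : ℕ, List.replicate m u ++ [v] <+: List.replicate n u ++ [v] → m = n := by
    intro m
    induction m with
    | zero =>
      rintro (_ | n) h
      · rfl
      · simp [List.replicate_succ, huv.symm] at h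
    | succ m ih =>
      rintro (_ | n) h
      · simp [List.replicate_succ, huv] at h
      · rw [List.replicate_succ, List.replicate_succ, List.cons_append, List.cons_append,
          List.prefix_cons_inj] at h
        rw [ih n h]
  exact key _ _ h

/-- A prefix code encoding a prescribed finite set into a given prefix-free set. -/
lemma exists_prefixCode_mem {U Y : Type*} [Nontrivial U] [Countable Y]
    {T : Finset (List U)} (hpf : ∀ s ∈ T, ∀ t ∈ T, s <+: t → s = t)
    {A : Finset Y} (hA : A.card + 1 ≤ T.card) (hT : 2 ≤ T.card) :
    ∃ f : Y → List U, (∀ y, f y ≠ []) ∧ (∀ y z, f y <+: f z → y = z) ∧ ∀ y ∈ A, f y ∈ T := by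
  classical
  obtain ⟨g, -, hg⟩ := exists_prefixCode (U := U) (Y := Y)
  obtain ⟨t₀, ht₀⟩ : T.Nonempty := Finset.card_pos.1 (by omega)
  have hnil : [] ∉ T := by
    intro h
    have : T = {[]} := Finset.eq_singleton_iff_unique_mem.2
      ⟨h, fun s hs => (hpf [] h s hs List.nil_prefix).symm⟩
    simp [this] at hT
  obtain ⟨e, he, heinj⟩ : ∃ e : Y → List U, (∀ y ∈ A, e y ∈ T.erase t₀) ∧ Set.InjOn e A := by
    have : A.card ≤ (T.erase t₀).card := by rw [Finset.card_erase_of_mem ht₀]; omega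
    obtain ⟨B, hB, hBc⟩ := Finset.exists_subset_card_eq this
    obtain ⟨e⟩ : Nonempty (A ≃ B) := ⟨Finset.equivOfCardEq hBc.symm⟩
    refine ⟨fun y => if h : y ∈ A then e ⟨y, h⟩ else [], fun y hy => ?_, fun y hy z hz h => ?_⟩
    · simpa [hy] using Finset.mem_erase.1 (hB (e ⟨y, hy⟩).2)
    · simp only [Finset.mem_coe] at hy hz
      simpa [hy, hz] using h
  have heT (y : Y) (hy : y ∈ A) : e y ∈ T := Finset.mem_of_mem_erase (he y hy)
  have hne (y : Y) (hy : y ∈ A) : e y ≠ t₀ := Finset.ne_of_mem_erase (he y hy)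
  refine ⟨fun y => if y ∈ A then e y else t₀ ++ g y, fun y => ?_, fun y z h => ?_, fun y hy => ?_⟩
  · by_cases hy : y ∈ A
    · simp only [hy, if_true]
      exact fun h => hnil (h ▸ heT y hy)
    · have : t₀ ≠ [] := fun h => hnil (h ▸ ht₀)
      simp [hy, this]
  · by_cases hy : y ∈ A <;> by_cases hz : z ∈ A <;> simp only [hy, hz, if_true, if_false] at h
    · exact heinj hy hz (hpf _ (heT y hy) _ (heT z hz) h)
    · rcases List.prefix_or_prefix_of_prefix h (List.prefix_append t₀ (g z)) with h | h
      · exact absurd (hpf _ (heT y hy) _ ht₀ h) (hne y hy)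
      · exact absurd (hpf _ ht₀ _ (heT y hy) h).symm (hne y hy)
    · exact absurd (hpf _ ht₀ _ (heT z hz) ((List.prefix_append t₀ (g y)).trans h)).symm (hne z hz)
    · exact hg y z ((List.prefix_append_right_inj t₀).1 h)
  · simpa [hy] using heT y hy

/-! ### Probabilities of sets under a mass function -/

section prob

variable {Y : Type*} {P Q : Y → ℝ} {S T : Set Y}

lemma prob_nonneg_s15 (h0 : ∀ y, 0 ≤ P y) : 0 ≤ prob P S :=
  tsum_nonneg fun _ => Set.indicator_nonneg (fun y _ => h0 y) _

lemma prob_mono_of_support (h0 : ∀ y, 0 ≤ P y) (hP : Summable P)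
    (h : ∀ y ∈ S, P y ≠ 0 → y ∈ T) : prob P S ≤ prob P T := by
  refine (hP.indicator S).tsum_le_tsum (fun y => ?_) (hP.indicator T)
  by_cases hy : y ∈ S
  · by_cases hy0 : P y = 0
    · by_cases hT : y ∈ T <;> simp [hy, hT, hy0]
    · simp [hy, h y hy hy0]
  · simpa [hy] using Set.indicator_nonneg (fun y _ => h0 y) _

lemma prob_le_one (h0 : ∀ y, 0 ≤ P y) (h1 : HasSum P 1) : prob P S ≤ 1 := by
  have := prob_mono_of_support (T := Set.univ) h0 h1.summable fun y (_ : y ∈ S) _ => trivial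
  simpa [prob, h1.tsum_eq] using this

lemma prob_union_le (h0 : ∀ y, 0 ≤ P y) (hP : Summable P) :
    prob P (S ∪ T) ≤ prob P S + prob P T := by
  rw [prob, prob, prob, ← (hP.indicator S).tsum_add (hP.indicator T)]
  refine (hP.indicator _).tsum_le_tsum (fun y => ?_) ((hP.indicator S).add (hP.indicator T))
  by_cases hS : y ∈ S <;> by_cases hT : y ∈ T <;> simp [hS, hT, h0 y]

lemma prob_mixture (hP : Summable P) (hQ : Summable Q) (v w : ℝ) (S : Set Y) :
    prob (fun y => v * P y + w * Q y) S = v * prob P S + w * prob Q S := by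
  rw [prob, prob, prob, ← tsum_mul_left, ← tsum_mul_left,
    ← ((hP.indicator S).mul_left v).tsum_add ((hQ.indicator S).mul_left w)]
  refine tsum_congr fun y => ?_
  by_cases hy : y ∈ S <;> simp [hy]

lemma prob_le_mul_of_card_le (h0 : ∀ y, 0 ≤ P y) {t M : ℝ} (ht : 0 ≤ t)
    (hPt : ∀ y ∈ S, P y ≤ t) (hM : ∀ F : Finset Y, (∀ y ∈ F, y ∈ S) → (F.card : ℝ) ≤ M) :
    prob P S ≤ M * t := by
  classical
  refine Real.tsum_le_of_sum_le (fun y => Set.indicator_nonneg (fun y _ => h0 y) y) fun F => ?_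
  calc ∑ y ∈ F, S.indicator P y = ∑ y ∈ F with y ∈ S, P y := by
        simp [Finset.sum_filter, Set.indicator_apply]
    _ ≤ (F.filter (· ∈ S)).card • t :=
        Finset.sum_le_card_nsmul _ _ _ fun y hy => hPt y (Finset.mem_filter.1 hy).2
    _ ≤ M * t := by
        rw [nsmul_eq_mul]
        exact mul_le_mul_of_nonneg_right (hM _ fun y hy => (Finset.mem_filter.1 hy).2) ht

end prob

/-! ### One-shot bounds on the overflow probability -/

section oneShot

variable {U Y : Type*} [Fintype U] {c : U → ℝ} {b α : ℝ} {P : Y → ℝ}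

/-- Strings of probability at least a constant multiple of `b ^ (-α ℓ)` can all be encoded at
cost at most `ℓ`. -/
lemma exists_prefixCode_strCost_le [Nontrivial U] [Countable Y] (hc : ∀ u, 0 < c u) (hb : 1 < b)
    (hα : 0 < α) (hroot : ∑ u, b ^ (-(α * c u)) = 1) (h0 : ∀ y, 0 ≤ P y) (h1 : HasSum P 1)
    {ℓ : ℝ} (hℓ : 0 ≤ ℓ) (hbig : 2 ≤ b ^ (α * (ℓ - ∑ u, c u))) :
    ∃ f : Y → List U, (∀ y, f y ≠ []) ∧ (∀ y z, f y <+: f z → y = z) ∧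
      ∀ y, 2 / b ^ (α * (ℓ - ∑ u, c u)) ≤ P y → strCost c (f y) ≤ ℓ := by
  obtain ⟨T, hpf, hcost, hcard⟩ := exists_prefixFree_card_ge hc hb hα hroot hℓ
  set B := b ^ (α * (ℓ - ∑ u, c u))
  have hB : 0 < B := by linarith
  have hfin : {y | 2 / B ≤ P y}.Finite := by
    have := h1.summable.tendsto_cofinite_zero.eventually_lt_const (div_pos two_pos hB)
    simpa [Filter.eventually_cofinite] using this
  have hA : (hfin.toFinset.card : ℝ) * (2 / B) ≤ 1 := by
    rw [← nsmul_eq_mul]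
    exact (Finset.card_nsmul_le_sum _ P _ fun y hy => hfin.mem_toFinset.1 hy).trans
      (sum_le_hasSum _ (fun y _ => h0 y) h1)
  have hA' : (hfin.toFinset.card : ℝ) * 2 ≤ B := by
    rwa [← mul_div_assoc, div_le_one hB] at hA
  obtain ⟨f, hne, hf, hfT⟩ := exists_prefixCode_mem (A := hfin.toFinset) hpf
    (by have : ((hfin.toFinset.card : ℝ) + 1) ≤ T.card := by linarith
        exact_mod_cast this)
    (by exact_mod_cast hbig.trans hcard)
  exact ⟨f, hne, hf, fun y hy => hcost _ (hfT y (hfin.mem_toFinset.2 hy))⟩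

/-- Lower bound on the overflow probability of a prefix code. -/
lemma prob_lt_le_prob_overflow_add (hb : 1 < b) (hα : 0 < α)
    (hroot : ∑ u, b ^ (-(α * c u)) = 1) (h0 : ∀ y, 0 ≤ P y) (hP : Summable P)
    {f : Y → List U} (hinj : Function.Injective f) (hpf : ∀ y z, f y <+: f z → f y = f z)
    (ℓ : ℝ) {t : ℝ} (ht : 0 ≤ t) :
    prob P {y | P y < t} ≤ prob P {y | ℓ < strCost c (f y)} + b ^ (α * ℓ) * t := by
  classical
  have hsub : prob P {y | P y < t} ≤
      prob P ({y | ℓ < strCost c (f y)} ∪ {y | P y < t ∧ strCost c (f y) ≤ ℓ}) :=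
    prob_mono_of_support h0 hP fun y hy _ => by
      rcases lt_or_ge ℓ (strCost c (f y)) with h | h
      exacts [Or.inl h, Or.inr ⟨hy, h⟩]
  refine hsub.trans ((prob_union_le h0 hP).trans (add_le_add_right ?_ _))
  refine prob_le_mul_of_card_le h0 ht (fun y hy => hy.1.le) fun F hF => ?_
  rw [← Finset.card_image_of_injective F hinj]
  refine card_le_of_prefixFree hb hα hroot ?_ ?_
  · simp only [Finset.mem_image]
    rintro _ ⟨y, -, rfl⟩ _ ⟨z, -, rfl⟩ h
    exact hpf y z h
  · simp only [Finset.mem_image]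
    rintro _ ⟨y, hy, rfl⟩
    exact (hF y hy).2

end oneShot

lemma prod_lt_rpow_neg_iff {ι 𝒳 : Type*} [Fintype ι] {P : 𝒳 → ℝ} (h0 : ∀ x, 0 ≤ P x) {b : ℝ}
    (hb : 1 < b) (z : ℝ) {x : ι → 𝒳} (hx : ∏ i, P (x i) ≠ 0) :
    ∏ i, P (x i) < b ^ (-z) ↔ z < ∑ i, Real.logb b (P (x i))⁻¹ := by
  have hpos : 0 < ∏ i, P (x i) := (Finset.prod_nonneg fun i _ => h0 _).lt_of_ne' hx
  have hne (i : ι) : P (x i) ≠ 0 := Finset.prod_ne_zero_iff.1 hx i (Finset.mem_univ i)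
  rw [← Real.logb_lt_iff_lt_rpow hb hpos, Real.logb_prod _ _ fun i _ => hne i]
  simp only [Real.logb_inv, Finset.sum_neg_distrib]
  constructor <;> intro h <;> linarith

/-- A source with non-degenerate self-information has positive entropy. -/
lemma entropy_pos {𝒳 : Type*} {P : 𝒳 → ℝ} (h0 : ∀ x, 0 ≤ P x) (h1 : HasSum P 1) {b H s : ℝ}
    (hb : 1 < b) (hH : HasSum (fun x => P x * Real.logb b (P x)⁻¹) H)
    (hvar : HasSum (fun x => P x * (Real.logb b (P x)⁻¹ - H) ^ 2) s) (hs : s ≠ 0) : 0 < H := by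
  have hterm (x : 𝒳) : 0 ≤ P x * Real.logb b (P x)⁻¹ := by
    rcases (h0 x).eq_or_lt with h | h
    · simp [← h]
    · exact mul_nonneg (h0 x) (Real.logb_nonneg hb
        ((one_le_inv₀ h).2 (le_hasSum h1 x fun y _ => h0 y)))
  refine (hH.nonneg hterm).lt_of_ne' fun hH0 => hs ?_
  subst hH0
  have hzero := (hasSum_zero_iff_of_nonneg hterm).1 hH
  refine hvar.unique ?_
  convert! hasSum_zero using 2 with x
  rcases mul_eq_zero.1 (congrFun hzero x) with h | h <;> simp [h]

/-! ### Asymptotics -/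

/-- Limit law of the information spectrum of an i.i.d. source. -/
lemma tendsto_prob_prod_lt {𝒳 : Type*} [Countable 𝒳] {P : 𝒳 → ℝ} (h0 : ∀ x, 0 ≤ P x)
    (h1 : HasSum P 1) {b H σ : ℝ} (hb : 1 < b) (hσ : 0 < σ)
    (hH : HasSum (fun x => P x * Real.logb b (P x)⁻¹) H)
    (hvar : HasSum (fun x => P x * (Real.logb b (P x)⁻¹ - H) ^ 2) (σ ^ 2)) (a : ℝ) :
    Tendsto (fun n : ℕ => prob (fun x : Fin n → 𝒳 => ∏ i, P (x i))
      {x | ∏ i, P (x i) < b ^ (-((n : ℝ) * H + a * √n))}) atTop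
      (𝓝 (1 - stdGaussianCDF (a / σ))) := by
  refine (tendsto_prob_sum_gt h0 h1 hσ hH hvar a).congr fun n => ?_
  have hQ0 (x : Fin n → 𝒳) : 0 ≤ ∏ i, P (x i) := Finset.prod_nonneg fun i _ => h0 _
  have hQs := (hasSum_prod_one h0 h1 n).summable
  exact le_antisymm
    (prob_mono_of_support hQ0 hQs fun x hx hne => (prod_lt_rpow_neg_iff h0 hb _ hne).2 hx)
    (prob_mono_of_support hQ0 hQs fun x hx hne => (prod_lt_rpow_neg_iff h0 hb _ hne).1 hx)

lemma tendsto_sqrt_natCast_atTop : Tendsto (fun n : ℕ => √(n : ℝ)) atTop atTop :=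
  Real.tendsto_sqrt_atTop.comp tendsto_natCast_atTop_atTop

lemma tendsto_rpow_mul_sqrt_atTop {b δ : ℝ} (hb : 1 < b) (hδ : 0 < δ) :
    Tendsto (fun n : ℕ => b ^ (δ * √(n : ℝ))) atTop atTop :=
  (tendsto_rpow_atTop_of_base_gt_one b hb).comp (tendsto_sqrt_natCast_atTop.const_mul_atTop hδ)

lemma tendsto_mul_add_mul_sqrt_atTop {H : ℝ} (hH : 0 < H) (a : ℝ) :
    Tendsto (fun n : ℕ => (n : ℝ) * H + a * √(n : ℝ)) atTop atTop := by
  have h : Tendsto (fun n : ℕ => √(n : ℝ) * (√(n : ℝ) * H + a)) atTop atTop :=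
    tendsto_sqrt_natCast_atTop.atTop_mul_atTop₀
      (tendsto_atTop_add_const_right _ _ (tendsto_sqrt_natCast_atTop.atTop_mul_const hH))
  refine h.congr fun n => ?_
  rw [mul_add, ← mul_assoc, Real.mul_self_sqrt n.cast_nonneg]
  ring

lemma csInf_eq_of_Ioi_subset {S : Set ℝ} {T : ℝ} (hmem : ∀ L, T < L → L ∈ S)
    (hle : ∀ L ∈ S, T ≤ L) : sInf S = T :=
  csInf_eq_of_forall_ge_of_forall_gt_exists_lt ⟨T + 1, hmem _ (lt_add_one T)⟩ hle fun L hL =>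
    ⟨(T + L) / 2, hmem _ (by linarith), by linarith⟩

/-- Second-order overflow threshold for a mixture of two i.i.d. sources with equal
entropies (Case I). -/
theorem second_order_mixed_equal_entropy {U 𝒳 : Type*} [Fintype U] [Countable 𝒳]
    (K : ℕ) (hK : 2 ≤ K) (hcard : Fintype.card U = K)
    (c : U → ℝ) (hc : ∀ u, 0 < c u)
    (α : ℝ) (hα : 0 < α) (hroot : ∑ u : U, (K : ℝ) ^ (-(α * c u)) = 1)
    (P₁ P₂ : 𝒳 → ℝ)
    (hP₁0 : ∀ x, 0 ≤ P₁ x) (hP₁1 : HasSum P₁ 1)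
    (hP₂0 : ∀ x, 0 ≤ P₂ x) (hP₂1 : HasSum P₂ 1)
    (H : ℝ)
    (hH₁ : HasSum (fun x => P₁ x * Real.logb K (P₁ x)⁻¹) H)
    (hH₂ : HasSum (fun x => P₂ x * Real.logb K (P₂ x)⁻¹) H)
    (σ₁ σ₂ : ℝ) (hσ₁ : 0 < σ₁) (hσ₂ : 0 < σ₂)
    (hvar₁ : HasSum (fun x => P₁ x * (Real.logb K (P₁ x)⁻¹ - H) ^ 2) (σ₁ ^ 2))
    (hvar₂ : HasSum (fun x => P₂ x * (Real.logb K (P₂ x)⁻¹ - H) ^ 2) (σ₂ ^ 2))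
    (w₁ w₂ : ℝ) (hw₁ : 0 < w₁) (hw₂ : 0 < w₂) (hw : w₁ + w₂ = 1)
    (ε : ℝ) (hε0 : 0 < ε) (hε1 : ε < 1) (hεw : ε ≠ w₁)
    (T₁ : ℝ)
    (hT₁ : ε = 1 - w₁ * stdGaussianCDF (T₁ * α / σ₁) - w₂ * stdGaussianCDF (T₁ * α / σ₂)) :
    sInf {L : ℝ | ∃ φ : ∀ n, (Fin n → 𝒳) → List U,
        (∀ n, Function.Injective (φ n)) ∧ (∀ n x, φ n x ≠ []) ∧
        (∀ n x y, φ n x <+: φ n y → φ n x = φ n y) ∧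
        Filter.limsup
          (fun n => prob
            (fun x : Fin n → 𝒳 => w₁ * ∏ i, P₁ (x i) + w₂ * ∏ i, P₂ (x i))
            {x | (n : ℝ) * (H / α) + L * Real.sqrt n < strCost c (φ n x)})
          Filter.atTop ≤ ε}
      = T₁ := by
  have hU : Nontrivial U := Fintype.one_lt_card_iff_nontrivial.1 (by omega)
  have hb : (1 : ℝ) < K := by exact_mod_cast (by omega : 1 < K)
  have hb0 : (0 : ℝ) < K := by linarith
  have hH : 0 < H := entropy_pos hP₁0 hP₁1 hb hH₁ hvar₁ (by positivity)
  have hQ₁0 (n : ℕ) (x : Fin n → 𝒳) : 0 ≤ ∏ i, P₁ (x i) := Finset.prod_nonneg fun i _ => hP₁0 _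
  have hQ₂0 (n : ℕ) (x : Fin n → 𝒳) : 0 ≤ ∏ i, P₂ (x i) := Finset.prod_nonneg fun i _ => hP₂0 _
  have hQ₁1 := hasSum_prod_one hP₁0 hP₁1
  have hQ₂1 := hasSum_prod_one hP₂0 hP₂1
  have hM0 (n : ℕ) (x : Fin n → 𝒳) : 0 ≤ w₁ * ∏ i, P₁ (x i) + w₂ * ∏ i, P₂ (x i) :=
    add_nonneg (mul_nonneg hw₁.le (hQ₁0 n x)) (mul_nonneg hw₂.le (hQ₂0 n x))
  have hM1 (n : ℕ) : HasSum
      (fun x : Fin n → 𝒳 => w₁ * ∏ i, P₁ (x i) + w₂ * ∏ i, P₂ (x i)) 1 := by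
    simpa [hw] using ((hQ₁1 n).mul_left w₁).add ((hQ₂1 n).mul_left w₂)
  have hmix (n : ℕ) (S : Set (Fin n → 𝒳)) :=
    prob_mixture (hQ₁1 n).summable (hQ₂1 n).summable w₁ w₂ S
  have hlim (a : ℝ) : Tendsto (fun n : ℕ =>
      w₁ * prob (fun x : Fin n → 𝒳 => ∏ i, P₁ (x i))
        {x | ∏ i, P₁ (x i) < (K : ℝ) ^ (-((n : ℝ) * H + a * √n))} +
      w₂ * prob (fun x : Fin n → 𝒳 => ∏ i, P₂ (x i))
        {x | ∏ i, P₂ (x i) < (K : ℝ) ^ (-((n : ℝ) * H + a * √n))}) atTop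
      (𝓝 (w₁ * (1 - stdGaussianCDF (a / σ₁)) + w₂ * (1 - stdGaussianCDF (a / σ₂)))) :=
    ((tendsto_prob_prod_lt hP₁0 hP₁1 hb hσ₁ hH₁ hvar₁ a).const_mul w₁).add
      ((tendsto_prob_prod_lt hP₂0 hP₂1 hb hσ₂ hH₂ hvar₂ a).const_mul w₂)
  have hαℓ (L : ℝ) (n : ℕ) :
      α * ((n : ℝ) * (H / α) + L * √n) = (n : ℝ) * H + α * L * √n := by
    field_simp
  have hthreshold (a : ℝ) : w₁ * (1 - stdGaussianCDF (a / σ₁)) +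
      w₂ * (1 - stdGaussianCDF (a / σ₂)) =
      1 - w₁ * stdGaussianCDF (a / σ₁) - w₂ * stdGaussianCDF (a / σ₂) := by
    linear_combination hw
  refine csInf_eq_of_Ioi_subset (fun L hL => ?_) fun L hL => ?_
  · set ℓ : ℕ → ℝ := fun n => (n : ℝ) * (H / α) + L * √n
    set D := ∑ u, c u
    have hcode (n : ℕ) : ∃ f : (Fin n → 𝒳) → List U, (∀ y, f y ≠ []) ∧
        (∀ y z, f y <+: f z → y = z) ∧
        (0 ≤ ℓ n → 2 ≤ (K : ℝ) ^ (α * (ℓ n - D)) →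
          ∀ x, 2 / (K : ℝ) ^ (α * (ℓ n - D)) ≤ w₁ * ∏ i, P₁ (x i) + w₂ * ∏ i, P₂ (x i) →
            strCost c (f x) ≤ ℓ n) := by
      by_cases h : 0 ≤ ℓ n ∧ 2 ≤ (K : ℝ) ^ (α * (ℓ n - D))
      · obtain ⟨f, hne, hf, hcost⟩ :=
          exists_prefixCode_strCost_le hc hb hα hroot (hM0 n) (hM1 n) h.1 h.2
        exact ⟨f, hne, hf, fun _ _ => hcost⟩
      · obtain ⟨f, hne, hf⟩ := exists_prefixCode (U := U) (Y := Fin n → 𝒳)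
        exact ⟨f, hne, hf, fun h1 h2 => absurd ⟨h1, h2⟩ h⟩
    choose φ hne hpf hcost using hcode
    refine ⟨φ, fun n x y h => hpf n x y (h ▸ List.prefix_rfl), hne,
      fun n x y h => by rw [hpf n x y h], ?_⟩
    have hℓ : Tendsto ℓ atTop atTop := tendsto_mul_add_mul_sqrt_atTop (div_pos hH hα) L
    have hB : Tendsto (fun n => (K : ℝ) ^ (α * (ℓ n - D))) atTop atTop :=
      (tendsto_rpow_atTop_of_base_gt_one _ hb).comp
        ((tendsto_atTop_add_const_right _ (-D) hℓ).const_mul_atTop hα)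
    have hgap := tendsto_rpow_mul_sqrt_atTop hb (mul_pos hα (sub_pos.2 hL))
    have hcomp {w q : ℝ} {n : ℕ} (hw : 0 < w) (hq : w * q < 2 / (K : ℝ) ^ (α * (ℓ n - D)))
        (hn : 2 * (K : ℝ) ^ (α * D) / w ≤ (K : ℝ) ^ (α * (L - T₁) * √n)) :
        q < (K : ℝ) ^ (-((n : ℝ) * H + α * T₁ * √n)) := by
      have hpow : 2 / (K : ℝ) ^ (α * (ℓ n - D)) =
          2 * (K : ℝ) ^ (α * D) * (K : ℝ) ^ (-((n : ℝ) * H + α * L * √n)) := by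
        rw [mul_sub, hαℓ L n, Real.rpow_sub hb0, Real.rpow_neg hb0.le, div_div_eq_mul_div,
          div_eq_mul_inv]
      calc q < 2 * (K : ℝ) ^ (α * D) / w * (K : ℝ) ^ (-((n : ℝ) * H + α * L * √n)) := by
            rw [hpow] at hq
            rw [div_mul_eq_mul_div, lt_div_iff₀ hw]
            linarith
        _ ≤ (K : ℝ) ^ (α * (L - T₁) * √n) * (K : ℝ) ^ (-((n : ℝ) * H + α * L * √n)) := by gcongr
        _ = (K : ℝ) ^ (-((n : ℝ) * H + α * T₁ * √n)) := by
            rw [← Real.rpow_add hb0]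
            ring_nf
    have hlimT := hlim (α * T₁)
    rw [hthreshold, mul_comm α, ← hT₁] at hlimT
    rw [← hlimT.limsup_eq]
    refine limsup_le_limsup ?_
      (isBoundedUnder_of ⟨0, fun n => prob_nonneg_s15 (hM0 n)⟩).isCoboundedUnder_le
      hlimT.isBoundedUnder_le
    filter_upwards [hℓ.eventually_ge_atTop 0, hB.eventually_ge_atTop 2,
      hgap.eventually_ge_atTop (2 * (K : ℝ) ^ (α * D) / w₁),
      hgap.eventually_ge_atTop (2 * (K : ℝ) ^ (α * D) / w₂)] with n hn0 hn2 hn₁ hn₂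
    have hover (x : Fin n → 𝒳) (hx : ℓ n < strCost c (φ n x)) :
        w₁ * ∏ i, P₁ (x i) + w₂ * ∏ i, P₂ (x i) < 2 / (K : ℝ) ^ (α * (ℓ n - D)) :=
      lt_of_not_ge fun h => hx.not_ge (hcost n hn0 hn2 x h)
    rw [hmix, mul_comm T₁ α]
    refine add_le_add (mul_le_mul_of_nonneg_left ?_ hw₁.le) (mul_le_mul_of_nonneg_left ?_ hw₂.le)
    · refine prob_mono_of_support (hQ₁0 n) (hQ₁1 n).summable fun x hx _ => hcomp hw₁ ?_ hn₁
      exact (le_add_of_nonneg_right (mul_nonneg hw₂.le (hQ₂0 n x))).trans_lt (hover x hx)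
    · refine prob_mono_of_support (hQ₂0 n) (hQ₂1 n).summable fun x hx _ => hcomp hw₂ ?_ hn₂
      exact (le_add_of_nonneg_left (mul_nonneg hw₁.le (hQ₁0 n x))).trans_lt (hover x hx)
  · obtain ⟨φ, hinj, -, hpf, hlimsup⟩ := hL
    by_contra! hLT
    set a := α * ((L + T₁) / 2)
    set δ := α * ((T₁ - L) / 2)
    have hδ : 0 < δ := mul_pos hα (by linarith)
    have haT : a < T₁ * α := by
      rw [mul_comm T₁]
      exact mul_lt_mul_of_pos_left (by linarith) hα
    have herr : Tendsto (fun n : ℕ => ((K : ℝ) ^ (δ * √(n : ℝ)))⁻¹) atTop (𝓝 0) :=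
      (tendsto_rpow_mul_sqrt_atTop hb hδ).inv_tendsto_atTop
    have hlow := (hlim a).sub herr
    rw [hthreshold, sub_zero] at hlow
    have hle := limsup_le_limsup (f := atTop) (Eventually.of_forall fun n : ℕ => ?_)
      hlow.isBoundedUnder_ge.isCoboundedUnder_le
      (isBoundedUnder_of ⟨1, fun n => prob_le_one (S := {x |
        (n : ℝ) * (H / α) + L * √n < strCost c (φ n x)}) (hM0 n) (hM1 n)⟩)
    · rw [hlow.limsup_eq] at hle
      have h₁ := mul_lt_mul_of_pos_left
        (strictMono_stdGaussianCDF (div_lt_div_of_pos_right haT hσ₁)) hw₁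
      have h₂ := mul_lt_mul_of_pos_left
        (strictMono_stdGaussianCDF (div_lt_div_of_pos_right haT hσ₂)) hw₂
      linarith
    · set t := (K : ℝ) ^ (-((n : ℝ) * H + a * √n))
      set ℓ := (n : ℝ) * (H / α) + L * √n
      have ht : 0 ≤ t := by positivity
      have hprod : (K : ℝ) ^ (α * ℓ) * t = ((K : ℝ) ^ (δ * √(n : ℝ)))⁻¹ := by
        rw [hαℓ L n, ← Real.rpow_add hb0, ← Real.rpow_neg hb0.le]
        simp only [a, δ]
        ring_nf
      have hc₁ := mul_le_mul_of_nonneg_left (prob_lt_le_prob_overflow_add hb hα hroot (hQ₁0 n)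
        (hQ₁1 n).summable (hinj n) (hpf n) ℓ ht) hw₁.le
      have hc₂ := mul_le_mul_of_nonneg_left (prob_lt_le_prob_overflow_add hb hα hroot (hQ₂0 n)
        (hQ₂1 n).summable (hinj n) (hpf n) ℓ ht) hw₂.le
      rw [hprod] at hc₁ hc₂
      rw [hmix]
      linear_combination hc₁ + hc₂ + hw * ((K : ℝ) ^ (δ * √(n : ℝ)))⁻¹
end
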